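/- arXiv:2502.11320 — 13 statements merged into one kernel-verified Lean document; each statement's English description precedes it below -/
import Mathlib

section
/- Let α>0 and g:[0,∞)→[1,∞). Then there exists a constant C>0 such that t₀(s) ≤ C·(1 + log(2+s)/g(s)) for all s≥0. -/
/-- For `α > 0`, `g : [0,∞) → [1,∞)` and `t₀ s` the unique positive solution of
`exp (-(t * g s)) = t / (1+s)^α`, there is a constant `C > 0` such that
`t₀ s ≤ C * (1 + log (2+s) / g s)` for all `s ≥ 0`. -/
theorem stmt_2 (α : ℝ) (hα : 0 < α) (g : ℝ → ℝ) (hg : ∀ s : ℝ, 0 ≤ s → 1 ≤ g s)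
    (t₀ : ℝ → ℝ)
    (ht₀ : ∀ s : ℝ, 0 ≤ s →
      0 < t₀ s ∧ Real.exp (-(t₀ s * g s)) = t₀ s / (1 + s) ^ α) :
    ∃ C : ℝ, 0 < C ∧ ∀ s : ℝ, 0 ≤ s → t₀ s ≤ C * (1 + Real.log (2 + s) / g s) := by
  refine ⟨1 + α, by linarith, fun s hs => ?_⟩
  obtain ⟨ht, he⟩ := ht₀ s hs
  have hg1 := hg s hs
  have hg0 : 0 < g s := by linarith
  have hlog : 0 ≤ Real.log (2 + s) / g s :=
    div_nonneg (Real.log_nonneg (by linarith)) hg0.le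
  rcases le_total (t₀ s) 1 with h1 | h1
  · nlinarith [mul_nonneg hα.le hlog]
  · have hs1 : (0 : ℝ) < 1 + s := by linarith
    have hlogs := congrArg Real.log he
    rw [Real.log_exp, Real.log_div ht.ne' (Real.rpow_pos_of_pos hs1 α).ne',
      Real.log_rpow hs1] at hlogs
    have hmono : α * Real.log (1 + s) ≤ α * Real.log (2 + s) :=
      mul_le_mul_of_nonneg_left (Real.log_le_log hs1 (by linarith)) hα.le
    have hbound : t₀ s ≤ α * (Real.log (2 + s) / g s) := by
      rw [← mul_div_assoc, le_div_iff₀ hg0]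
      linarith [Real.log_nonneg h1]
    linarith
end

section
/- Let α>0, g:[0,∞)→[1,∞) and c₀>0. Then for all s≥0 and all t with 0<t≤c₀·t₀(s), one has t/(1+s)^α ≤ c₀·exp(−t·g(s)/c₀). -/
/-- For `α > 0`, `g : [0,∞) → [1,∞)`, `t₀ s` the unique positive solution of
`exp (-(t * g s)) = t / (1+s)^α`, and `c₀ > 0`: for all `s ≥ 0` and `0 < t ≤ c₀ * t₀ s`,
one has `t / (1+s)^α ≤ c₀ * exp (-(t * g s / c₀))`. -/
theorem stmt_4 (α : ℝ) (hα : 0 < α) (g : ℝ → ℝ) (hg : ∀ s : ℝ, 0 ≤ s → 1 ≤ g s)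
    (t₀ : ℝ → ℝ)
    (ht₀ : ∀ s : ℝ, 0 ≤ s →
      0 < t₀ s ∧ Real.exp (-(t₀ s * g s)) = t₀ s / (1 + s) ^ α)
    (c₀ : ℝ) (hc₀ : 0 < c₀) :
    ∀ s : ℝ, 0 ≤ s → ∀ t : ℝ, 0 < t → t ≤ c₀ * t₀ s →
      t / (1 + s) ^ α ≤ c₀ * Real.exp (-(t * g s / c₀)) := by
  intro s hs t _ htle
  obtain ⟨_, heq⟩ := ht₀ s hs
  have hg0 : 0 ≤ g s := zero_le_one.trans (hg s hs)
  have hpow : 0 < (1 + s) ^ α := Real.rpow_pos_of_pos (by linarith) α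
  have hdiv : t / c₀ ≤ t₀ s := (div_le_iff₀' hc₀).2 htle
  have hexp : t * g s / c₀ ≤ t₀ s * g s := by
    rw [mul_div_right_comm]
    exact mul_le_mul_of_nonneg_right hdiv hg0
  calc t / (1 + s) ^ α ≤ c₀ * t₀ s / (1 + s) ^ α := by gcongr
    _ = c₀ * Real.exp (-(t₀ s * g s)) := by rw [heq, mul_div_assoc]
    _ ≤ c₀ * Real.exp (-(t * g s / c₀)) := by gcongr
end

section
/- Let α>0 and g:[0,∞)→[1,∞). For every κ>0 there exists a constant C>0 such that exp(−κ·t₀(s)·g(s)) ≤ C·(log(2+s))^{κ}·(1+s)^{−κα} for all s≥0. -/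
/-- A positive solution `t` of `exp (-(t * b)) = t / (1+s)^α` with `b ≥ 1` grows at most
logarithmically in `s`. -/
theorem le_mul_log_of_exp_neg_mul_eq {α b s t : ℝ} (hα : 0 < α) (hb : 1 ≤ b) (hs : 0 ≤ s)
    (ht : 0 < t) (h : Real.exp (-(t * b)) = t / (1 + s) ^ α) :
    t ≤ (α + 1 / Real.log 2) * Real.log (2 + s) := by
  have hlog2 : 0 < Real.log 2 := Real.log_pos one_lt_two
  have hmono : Real.log 2 ≤ Real.log (2 + s) := Real.log_le_log two_pos (by linarith)
  have hone : 1 ≤ 1 / Real.log 2 * Real.log (2 + s) := by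
    rw [one_div_mul_eq_div]
    exact (one_le_div hlog2).2 hmono
  have hαlog : 0 ≤ α * Real.log (2 + s) := mul_nonneg hα.le (hlog2.le.trans hmono)
  rw [add_mul]
  rcases le_total t 1 with ht1 | ht1
  · linarith
  · have hs1 : 0 < 1 + s := by linarith
    have hlog := congrArg Real.log h
    rw [Real.log_exp, Real.log_div ht.ne' (Real.rpow_pos_of_pos hs1 α).ne',
      Real.log_rpow hs1] at hlog
    have hlogt : 0 ≤ Real.log t := Real.log_nonneg ht1
    have htb : t ≤ t * b := le_mul_of_one_le_right ht.le hb
    have hle : α * Real.log (1 + s) ≤ α * Real.log (2 + s) :=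
      mul_le_mul_of_nonneg_left (Real.log_le_log hs1 (by linarith)) hα.le
    linarith

/-- For `α > 0`, `g : [0,∞) → [1,∞)` and `t₀ s` the unique positive solution of
`exp (-(t * g s)) = t / (1+s)^α`: for every `κ > 0` there is `C > 0` such that
`exp (-(κ * t₀ s * g s)) ≤ C * (log (2+s))^κ * (1+s)^{-κα}` for all `s ≥ 0`. -/
theorem stmt_6 (α : ℝ) (hα : 0 < α) (g : ℝ → ℝ) (hg : ∀ s : ℝ, 0 ≤ s → 1 ≤ g s)
    (t₀ : ℝ → ℝ)
    (ht₀ : ∀ s : ℝ, 0 ≤ s →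
      0 < t₀ s ∧ Real.exp (-(t₀ s * g s)) = t₀ s / (1 + s) ^ α) :
    ∀ κ : ℝ, 0 < κ → ∃ C : ℝ, 0 < C ∧ ∀ s : ℝ, 0 ≤ s →
      Real.exp (-(κ * t₀ s * g s)) ≤
        C * Real.log (2 + s) ^ κ * (1 + s) ^ (-(κ * α)) := by
  intro κ hκ
  have hK : 0 < α + 1 / Real.log 2 :=
    add_pos hα (one_div_pos.2 (Real.log_pos one_lt_two))
  refine ⟨(α + 1 / Real.log 2) ^ κ, Real.rpow_pos_of_pos hK κ, fun s hs => ?_⟩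
  obtain ⟨ht, h⟩ := ht₀ s hs
  have hs1 : 0 ≤ 1 + s := by linarith
  have hlog : 0 ≤ Real.log (2 + s) := Real.log_nonneg (by linarith)
  calc Real.exp (-(κ * t₀ s * g s)) = Real.exp (-(t₀ s * g s)) ^ κ := by
        rw [← Real.exp_mul]
        ring_nf
    _ = t₀ s ^ κ * (1 + s) ^ (-(κ * α)) := by
        rw [h, Real.div_rpow ht.le (Real.rpow_nonneg hs1 α), ← Real.rpow_mul hs1,
          Real.rpow_neg hs1, mul_comm α κ, div_eq_mul_inv]
    _ ≤ ((α + 1 / Real.log 2) * Real.log (2 + s)) ^ κ * (1 + s) ^ (-(κ * α)) := by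
        gcongr
        exact le_mul_log_of_exp_neg_mul_eq hα (hg s hs) hs ht h
    _ = (α + 1 / Real.log 2) ^ κ * Real.log (2 + s) ^ κ * (1 + s) ^ (-(κ * α)) := by
        rw [Real.mul_rpow hK.le hlog]
end

section
/- Let d∈ℕ, α>0, and let g:[0,∞)→[1,∞) be non-decreasing with lim_{r→∞} g(r)=∞. Then for every c>0 the integral ∫_{ℝ^d} exp(c·t₀(|w|))·g(|w|)^{−2}·(1+|w|)^{−2(d+α)} dw is finite. -/
open MeasureTheory

/-- If `exp (-(t * G)) = t / (1 + s) ^ α` with `G > 0`, then `t ≤ 1 + α * log (1 + s) / G`. -/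
theorem le_one_add_log_div_of_exp_eq {α s G t : ℝ} (hα : 0 ≤ α) (hs : 0 ≤ s) (hG : 0 < G)
    (h : Real.exp (-(t * G)) = t / (1 + s) ^ α) :
    t ≤ 1 + α * Real.log (1 + s) / G := by
  have hs1 : (0 : ℝ) < 1 + s := by linarith
  have hlog : 0 ≤ Real.log (1 + s) := Real.log_nonneg (by linarith)
  rcases le_total t 1 with ht | ht
  · have : 0 ≤ α * Real.log (1 + s) / G := by positivity
    linarith
  · have hpow : 0 < (1 + s) ^ α := Real.rpow_pos_of_pos hs1 α
    have hlogeq : -(t * G) = Real.log t - α * Real.log (1 + s) := by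
      rw [← Real.log_exp (-(t * G)), h, Real.log_div (by linarith) hpow.ne', Real.log_rpow hs1]
    have hlogt : 0 ≤ Real.log t := Real.log_nonneg ht
    have : t ≤ α * Real.log (1 + s) / G := by
      rw [le_div_iff₀ hG]
      linarith
    linarith

/-- If `g ≥ 1` tends to infinity, then `exp (c * t₀ s)` is `O((1 + s) ^ α)` on `[0, ∞)`. -/
theorem exists_exp_mul_le_mul_rpow {α c : ℝ} (hα : 0 ≤ α) (hc : 0 < c) {g t₀ : ℝ → ℝ}
    (hg1 : ∀ r : ℝ, 0 ≤ r → 1 ≤ g r)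
    (hlim : Filter.Tendsto g Filter.atTop Filter.atTop)
    (ht₀ : ∀ s : ℝ, 0 ≤ s → Real.exp (-(t₀ s * g s)) = t₀ s / (1 + s) ^ α) :
    ∃ C : ℝ, 0 ≤ C ∧ ∀ s : ℝ, 0 ≤ s → Real.exp (c * t₀ s) ≤ C * (1 + s) ^ α := by
  obtain ⟨R, hR⟩ := Filter.eventually_atTop.1 (hlim.eventually_ge_atTop c)
  refine ⟨Real.exp (c * (1 + α * Real.log (1 + |R|))), (Real.exp_pos _).le, fun s hs => ?_⟩
  have hs1 : (0 : ℝ) < 1 + s := by linarith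
  have hg : 0 < g s := zero_lt_one.trans_le (hg1 s hs)
  have hlog : 0 ≤ α * Real.log (1 + s) := mul_nonneg hα (Real.log_nonneg (by linarith))
  have hlogR : 0 ≤ α * Real.log (1 + |R|) :=
    mul_nonneg hα (Real.log_nonneg (by linarith [abs_nonneg R]))
  have ht := le_one_add_log_div_of_exp_eq hα hs hg (ht₀ s hs)
  rw [Real.rpow_def_of_pos hs1, ← Real.exp_add, Real.exp_le_exp]
  rcases le_total R s with hRs | hRs
  · have hdiv : c * (α * Real.log (1 + s) / g s) ≤ α * Real.log (1 + s) := by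
      rw [← mul_div_assoc, div_le_iff₀ hg, mul_comm]
      exact mul_le_mul_of_nonneg_left (hR s hRs) hlog
    nlinarith [mul_le_mul_of_nonneg_left ht hc.le, mul_nonneg hc.le hlogR]
  · have hdiv : α * Real.log (1 + s) / g s ≤ α * Real.log (1 + s) :=
      div_le_self hlog (hg1 s hs)
    have hle : α * Real.log (1 + s) ≤ α * Real.log (1 + |R|) :=
      mul_le_mul_of_nonneg_left
        (Real.log_le_log hs1 (by linarith [le_abs_self R])) hα
    have htR : t₀ s ≤ 1 + α * Real.log (1 + |R|) := by linarith
    linarith [mul_le_mul_of_nonneg_left htR hc.le]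

/-- For `d ∈ ℕ`, `α > 0`, `g : [0,∞) → [1,∞)` non-decreasing with `g r → ∞` as `r → ∞`,
and `t₀ s` the unique positive solution of `exp (-(t * g s)) = t / (1+s)^α`: for every
`c > 0`, the integral `∫_{ℝ^d} exp (c * t₀ |w|) * g(|w|)⁻² * (1+|w|)^{-2(d+α)} dw` is
finite. -/
theorem stmt_7 (d : ℕ) (hd : 0 < d) (α : ℝ) (hα : 0 < α) (g : ℝ → ℝ)
    (hg1 : ∀ r : ℝ, 0 ≤ r → 1 ≤ g r)
    (hmono : ∀ r s : ℝ, 0 ≤ r → r ≤ s → g r ≤ g s)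
    (hlim : Filter.Tendsto g Filter.atTop Filter.atTop)
    (t₀ : ℝ → ℝ)
    (ht₀ : ∀ s : ℝ, 0 ≤ s →
      0 < t₀ s ∧ Real.exp (-(t₀ s * g s)) = t₀ s / (1 + s) ^ α)
    (c : ℝ) (hc : 0 < c) :
    ∫⁻ w : EuclideanSpace ℝ (Fin d),
      ENNReal.ofReal
        (Real.exp (c * t₀ ‖w‖) * (g ‖w‖)⁻¹ ^ 2 *
          (1 + ‖w‖) ^ (-(2 * ((d : ℝ) + α)))) < ⊤ := by
  obtain ⟨C, hC, hbound⟩ :=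
    exists_exp_mul_le_mul_rpow hα.le hc hg1 hlim fun s hs => (ht₀ s hs).2
  have hfin : ∫⁻ w : EuclideanSpace ℝ (Fin d),
      ENNReal.ofReal ((1 + ‖w‖) ^ (-(2 * (d : ℝ) + α))) < ⊤ := by
    refine finite_integral_one_add_norm ?_
    have hd' : (0 : ℝ) < d := by exact_mod_cast hd
    rw [finrank_euclideanSpace_fin]
    linarith
  calc
    _ ≤ ∫⁻ w : EuclideanSpace ℝ (Fin d),
        ENNReal.ofReal C * ENNReal.ofReal ((1 + ‖w‖) ^ (-(2 * (d : ℝ) + α))) := by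
      refine lintegral_mono fun w => ?_
      rw [← ENNReal.ofReal_mul hC]
      refine ENNReal.ofReal_le_ofReal ?_
      have hw : (0 : ℝ) < 1 + ‖w‖ := by positivity
      have hginv : (g ‖w‖)⁻¹ ^ 2 ≤ 1 :=
        pow_le_one₀ (inv_nonneg.2 (zero_le_one.trans (hg1 _ (norm_nonneg w))))
          (inv_le_one_of_one_le₀ (hg1 _ (norm_nonneg w)))
      calc
        _ ≤ C * (1 + ‖w‖) ^ α * 1 * (1 + ‖w‖) ^ (-(2 * ((d : ℝ) + α))) := by
          gcongr
          exact hbound _ (norm_nonneg w)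
        _ = C * (1 + ‖w‖) ^ (-(2 * (d : ℝ) + α)) := by
          rw [mul_one, mul_assoc, ← Real.rpow_add hw]
          ring_nf
    _ < ⊤ := by
      rw [lintegral_const_mul' _ _ ENNReal.ofReal_ne_top]
      exact ENNReal.mul_lt_top ENNReal.ofReal_lt_top hfin
end

section
/- Let α>0 and β>0, and set g(s) = log^β(e+s) for s≥0. Then there exists a constant C≥1 such that C^{−1}·log^{1−β}(2+s) ≤ t₀(s) ≤ C·log^{1−β}(2+s) for all s≥0. -/
/-- If `x * L + log x + (1 - β) * log L = α * m` with `m ≤ L`, then `x` is at most `1 + α + β`. -/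
lemma le_of_mul_add_log_eq {α β L m x : ℝ} (hα : 0 < α) (hβ : 0 < β) (hL : 1 ≤ L) (hm : m ≤ L)
    (h : x * L + Real.log x + (1 - β) * Real.log L = α * m) : x ≤ 1 + α + β := by
  by_contra! hx
  have hlogx : 0 ≤ Real.log x := Real.log_nonneg (by linarith)
  have hlogL : 0 ≤ Real.log L := Real.log_nonneg hL
  have hlogL' : Real.log L ≤ L := Real.log_le_self (by linarith)
  nlinarith [mul_le_mul_of_nonneg_left hlogL' hβ.le, mul_le_mul_of_nonneg_left hm hα.le,
    mul_lt_mul_of_pos_right hx (by linarith : 0 < L)]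

/-- If `x * L + log x + (1 - β) * log L = α * m` with `L - 1 ≤ m`, then `x` is at least
`α / 4 * exp (-α)`. -/
lemma ge_of_mul_add_log_eq {α β L m x : ℝ} (hα : 0 < α) (hβ : 0 < β) (hL : 1 ≤ L)
    (hm : L - 1 ≤ m) (hx : 0 < x)
    (h : x * L + Real.log x + (1 - β) * Real.log L = α * m) : α / 4 * Real.exp (-α) ≤ x := by
  rcases le_total (α / 4) x with hxα | hxα
  · refine le_trans ?_ hxα
    exact mul_le_of_le_one_right (by positivity) (Real.exp_le_one_iff.2 (by linarith))
  · have hL0 : 0 < L := by linarith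
    have hlogL : 0 ≤ Real.log L := Real.log_nonneg hL
    have hsub : Real.log (α / 4 * L) ≤ α / 4 * L - 1 := Real.log_le_sub_one_of_pos (by positivity)
    rw [Real.log_mul (by positivity) hL0.ne'] at hsub
    rw [← Real.log_le_log_iff (by positivity) hx, Real.log_mul (by positivity) (Real.exp_ne_zero _),
      Real.log_exp]
    nlinarith [mul_le_mul_of_nonneg_left hm hα.le, mul_le_mul_of_nonneg_right hxα hL0.le,
      mul_nonneg hβ.le hlogL, mul_pos hα hL0]

/-- Positive numbers within a factor `2` of each other have powers within a factor `2 ^ |p|`. -/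
lemma rpow_le_two_rpow_abs_mul {p L M : ℝ} (hM : 0 < M) (hML : M ≤ L) (hLM : L ≤ 2 * M) :
    L ^ p ≤ 2 ^ |p| * M ^ p ∧ M ^ p ≤ 2 ^ |p| * L ^ p := by
  have hL : 0 < L := hM.trans_le hML
  have h2 : (1 : ℝ) ≤ 2 ^ |p| := Real.one_le_rpow (by norm_num) (abs_nonneg p)
  rcases le_total 0 p with hp | hp
  · refine ⟨?_, ?_⟩
    · rw [abs_of_nonneg hp, ← Real.mul_rpow (by norm_num) hM.le]
      exact Real.rpow_le_rpow hL.le hLM hp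
    · exact (Real.rpow_le_rpow hM.le hML hp).trans (le_mul_of_one_le_left (by positivity) h2)
  · refine ⟨?_, ?_⟩
    · exact (Real.rpow_le_rpow_of_nonpos hM hML hp).trans
        (le_mul_of_one_le_left (by positivity) h2)
    · have h := Real.rpow_le_rpow_of_nonpos hL hLM hp
      rw [Real.mul_rpow (by norm_num) hM.le] at h
      calc M ^ p = 2 ^ |p| * (2 ^ p * M ^ p) := by
            rw [← mul_assoc, ← Real.rpow_add (by norm_num), abs_of_nonpos hp, neg_add_cancel,
              Real.rpow_zero, one_mul]
        _ ≤ 2 ^ |p| * L ^ p := by gcongr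

/-- The defining equation of `t₀ s` in logarithmic form, after rescaling. -/
lemma mul_add_log_eq {α β L t s : ℝ} (hL : 0 < L) (ht : 0 < t) (hs : 0 ≤ s)
    (h : Real.exp (-(t * L ^ β)) = t / (1 + s) ^ α) :
    t / L ^ (1 - β) * L + Real.log (t / L ^ (1 - β)) + (1 - β) * Real.log L
      = α * Real.log (1 + s) := by
  have hQ : 0 < L ^ (1 - β) := Real.rpow_pos_of_pos hL _
  have hPQ : L ^ β * L ^ (1 - β) = L := by
    rw [← Real.rpow_add hL, add_sub_cancel, Real.rpow_one]
  have h1 : t / L ^ (1 - β) * L = t * L ^ β := by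
    rw [div_mul_eq_mul_div, div_eq_iff hQ.ne', mul_assoc, hPQ]
  have h2 := congrArg Real.log h
  rw [Real.log_exp, Real.log_div ht.ne' (by positivity), Real.log_rpow (by linarith)] at h2
  rw [h1, Real.log_div ht.ne' hQ.ne', Real.log_rpow hL]
  linarith

/-- For `α > 0`, `β > 0`, `g s = (log (e + s))^β`, and `t₀ s` the unique positive
solution of `exp (-(t * g s)) = t / (1+s)^α`: there is `C ≥ 1` with
`C⁻¹ * (log (2+s))^{1-β} ≤ t₀ s ≤ C * (log (2+s))^{1-β}` for all `s ≥ 0`. -/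
theorem stmt_8 (α β : ℝ) (hα : 0 < α) (hβ : 0 < β)
    (t₀ : ℝ → ℝ)
    (ht₀ : ∀ s : ℝ, 0 ≤ s →
      0 < t₀ s ∧
        Real.exp (-(t₀ s * Real.log (Real.exp 1 + s) ^ β)) = t₀ s / (1 + s) ^ α) :
    ∃ C : ℝ, 1 ≤ C ∧ ∀ s : ℝ, 0 ≤ s →
      C⁻¹ * Real.log (2 + s) ^ (1 - β) ≤ t₀ s ∧
        t₀ s ≤ C * Real.log (2 + s) ^ (1 - β) := by
  set D : ℝ := 2 ^ |1 - β|
  set a : ℝ := α / 4 * Real.exp (-α)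
  have hD : 1 ≤ D := Real.one_le_rpow (by norm_num) (abs_nonneg _)
  have ha : 0 < a := by positivity
  have hDa : 0 < D / a := by positivity
  refine ⟨(1 + α + β) * D + D / a, by nlinarith, fun s hs => ?_⟩
  obtain ⟨ht, heq⟩ := ht₀ s hs
  have he : 2 < Real.exp 1 := by linarith [Real.exp_one_gt_d9]
  have he' : Real.exp 1 < 3 := by linarith [Real.exp_one_lt_d9]
  have hL : 1 ≤ Real.log (Real.exp 1 + s) := by
    rw [Real.le_log_iff_exp_le (by linarith)]
    linarith
  have hm : Real.log (1 + s) ≤ Real.log (Real.exp 1 + s) :=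
    Real.log_le_log (by linarith) (by linarith)
  have hm' : Real.log (Real.exp 1 + s) - 1 ≤ Real.log (1 + s) := by
    have h : Real.log (Real.exp 1 + s) ≤ Real.log (Real.exp 1 * (1 + s)) :=
      Real.log_le_log (by linarith) (by nlinarith)
    rw [Real.log_mul (Real.exp_ne_zero _) (by linarith), Real.log_exp] at h
    linarith
  have hM : 0 < Real.log (2 + s) := Real.log_pos (by linarith)
  have hML : Real.log (2 + s) ≤ Real.log (Real.exp 1 + s) :=
    Real.log_le_log (by linarith) (by linarith)
  have hLM : Real.log (Real.exp 1 + s) ≤ 2 * Real.log (2 + s) := by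
    have h : Real.log (Real.exp 1 + s) ≤ Real.log ((2 + s) ^ 2) :=
      Real.log_le_log (by linarith) (by nlinarith)
    rwa [Real.log_pow, Nat.cast_ofNat] at h
  generalize Real.log (Real.exp 1 + s) = L at *
  generalize Real.log (2 + s) = M at *
  have hL0 : 0 < L := by linarith
  have hQ : 0 < L ^ (1 - β) := Real.rpow_pos_of_pos hL0 _
  have hR : 0 < M ^ (1 - β) := Real.rpow_pos_of_pos hM _
  have hx := mul_add_log_eq hL0 ht hs heq
  have hub := le_of_mul_add_log_eq hα hβ hL hm hx
  have hlb := ge_of_mul_add_log_eq hα hβ hL hm' (by positivity) hx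
  rw [div_le_iff₀ hQ] at hub
  rw [le_div_iff₀ hQ] at hlb
  obtain ⟨hLpow, hMpow⟩ := rpow_le_two_rpow_abs_mul (p := 1 - β) hM hML hLM
  refine ⟨?_, ?_⟩
  · rw [inv_mul_le_iff₀ (by positivity)]
    calc M ^ (1 - β) ≤ D * L ^ (1 - β) := hMpow
      _ = D / a * (a * L ^ (1 - β)) := by field_simp
      _ ≤ D / a * t₀ s := by gcongr
      _ ≤ ((1 + α + β) * D + D / a) * t₀ s := by
        gcongr
        exact le_add_of_nonneg_left (by positivity)
  · calc t₀ s ≤ (1 + α + β) * L ^ (1 - β) := hub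
      _ ≤ (1 + α + β) * (D * M ^ (1 - β)) := by gcongr
      _ = (1 + α + β) * D * M ^ (1 - β) := by ring
      _ ≤ ((1 + α + β) * D + D / a) * M ^ (1 - β) := by
        gcongr
        exact le_add_of_nonneg_right hDa.le
end

section
/- Let β>1 and d∈ℕ, and for t>0 set s₀(t) := max{exp(t^{−1/(β−1)}) − 2, 2}. For all c₀,c₁,c₂>0 there exist constants C,C'>0 such that for every t with 0<t≤2: ∫_{{z∈ℝ^d : |z| ≤ c₁·s₀(c₂·t)}} exp(−c₀·t·log^β(2+|z|)) dz ≤ C·exp(C'·t^{−1/(β−1)}). -/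
open MeasureTheory

/-- For `β > 1`, `d ∈ ℕ` and `s₀ t = max (exp (t^{-1/(β-1)}) - 2) 2`: for all
`c₀, c₁, c₂ > 0` there are `C, C' > 0` such that for all `0 < t ≤ 2`,
`∫_{|z| ≤ c₁ s₀(c₂ t)} exp (-(c₀ t (log (2+|z|))^β)) dz ≤ C exp (C' t^{-1/(β-1)})`. -/
theorem stmt_9 (β : ℝ) (hβ : 1 < β) (d : ℕ) (hd : 0 < d)
    (c₀ c₁ c₂ : ℝ) (hc₀ : 0 < c₀) (hc₁ : 0 < c₁) (hc₂ : 0 < c₂) :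
    ∃ C C' : ℝ, 0 < C ∧ 0 < C' ∧ ∀ t : ℝ, 0 < t → t ≤ 2 →
      (∫ z in {z : EuclideanSpace ℝ (Fin d) |
          ‖z‖ ≤ c₁ * max (Real.exp ((c₂ * t) ^ (-(1 / (β - 1)))) - 2) 2},
        Real.exp (-(c₀ * t * Real.log (2 + ‖z‖) ^ β))) ≤
      C * Real.exp (C' * t ^ (-(1 / (β - 1)))) := by
  set p : ℝ := -(1 / (β - 1)) with hp
  set V : ℝ := volume.real (Metric.ball (0 : EuclideanSpace ℝ (Fin d)) 1) with hV
  have hVpos : 0 < V :=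
    ENNReal.toReal_pos (Metric.measure_ball_pos volume _ one_pos).ne' measure_ball_lt_top.ne
  refine ⟨(c₁ * 2) ^ d * V, d * c₂ ^ p, by positivity, by positivity, fun t ht _ => ?_⟩
  set a : ℝ := (c₂ * t) ^ p with ha
  have ha' : a = c₂ ^ p * t ^ p := Real.mul_rpow hc₂.le ht.le
  have ha0 : 0 ≤ a := by positivity
  have hR : c₁ * max (Real.exp a - 2) 2 ≤ c₁ * 2 * Real.exp a := by
    have h1 : 1 ≤ Real.exp a := Real.one_le_exp ha0
    rw [mul_assoc]
    exact mul_le_mul_of_nonneg_left (max_le (by linarith) (by linarith)) hc₁.le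
  have hR0 : 0 ≤ c₁ * max (Real.exp a - 2) 2 := by positivity
  have hset : {z : EuclideanSpace ℝ (Fin d) | ‖z‖ ≤ c₁ * max (Real.exp a - 2) 2} =
      Metric.closedBall 0 (c₁ * max (Real.exp a - 2) 2) := by
    ext z
    simp
  rw [hset]
  calc
    _ ≤ 1 * volume.real (Metric.closedBall (0 : EuclideanSpace ℝ (Fin d))
          (c₁ * max (Real.exp a - 2) 2)) := by
      refine (Real.le_norm_self _).trans
        (norm_setIntegral_le_of_norm_le_const measure_closedBall_lt_top fun z _ => ?_)
      have hlog : 0 ≤ Real.log (2 + ‖z‖) := Real.log_nonneg (by linarith [norm_nonneg z])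
      rw [Real.norm_eq_abs, Real.abs_exp, Real.exp_le_one_iff, neg_nonpos]
      positivity
    _ = (c₁ * max (Real.exp a - 2) 2) ^ d * V := by
      rw [one_mul, Measure.addHaar_real_closedBall _ _ hR0, finrank_euclideanSpace_fin]
    _ ≤ (c₁ * 2 * Real.exp a) ^ d * V := by gcongr
    _ = (c₁ * 2) ^ d * V * Real.exp (d * c₂ ^ p * t ^ p) := by
      rw [mul_pow, ← Real.exp_nat_mul, ha', ← mul_assoc (d : ℝ)]
      ring
end

section
/- Let β>1, d∈ℕ and c₀>0, and for t>0 set s₀(t) := max{exp(t^{−1/(β−1)}) − 2, 2}. Then there exist constants c,c'>0 such that for every t with 0<t≤2: ∫_{{z∈ℝ^d : |z| ≤ s₀(t)}} exp(−c₀·t·log^β(2+|z|)) dz ≥ c·exp(c'·t^{−1/(β−1)}). -/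
open MeasureTheory

/-- A power of a sum of nonnegative reals is at most the sum of the powers of the doubles. -/
lemma rpow_add_le_two_mul_rpow {a b p : ℝ} (ha : 0 ≤ a) (hb : 0 ≤ b) (hp : 0 ≤ p) :
    (a + b) ^ p ≤ (2 * a) ^ p + (2 * b) ^ p := by
  rcases le_total a b with h | h
  · have h1 : (a + b) ^ p ≤ (2 * b) ^ p :=
      Real.rpow_le_rpow (by linarith) (by linarith) hp
    have h2 : 0 ≤ (2 * a) ^ p := by positivity
    linarith
  · have h1 : (a + b) ^ p ≤ (2 * a) ^ p :=
      Real.rpow_le_rpow (by linarith) (by linarith) hp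
    have h2 : 0 ≤ (2 * b) ^ p := by positivity
    linarith

/-- For every `K > 0` and `q > 0` there is `k ∈ (0, 1/2]` with `K * k ^ q ≤ 1/2`. -/
lemma exists_mul_rpow_le_half {K q : ℝ} (hK : 0 < K) (hq : 0 < q) :
    ∃ k : ℝ, 0 < k ∧ k ≤ 1 / 2 ∧ K * k ^ q ≤ 1 / 2 := by
  have hb : 0 < (1 / (2 * K)) ^ (1 / q) := by positivity
  refine ⟨min (1 / 2) ((1 / (2 * K)) ^ (1 / q)), lt_min (by norm_num) hb, min_le_left _ _, ?_⟩
  have h : (min (1 / 2) ((1 / (2 * K)) ^ (1 / q))) ^ q ≤ ((1 / (2 * K)) ^ (1 / q)) ^ q :=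
    Real.rpow_le_rpow (le_min (by norm_num) hb.le) (min_le_right _ _) hq.le
  rw [← Real.rpow_mul (by positivity), one_div_mul_cancel hq.ne', Real.rpow_one] at h
  calc K * _ ≤ K * (1 / (2 * K)) := by gcongr
    _ = 1 / 2 := by field_simp

/-- The weight `exp (-(a * log (2 + |z|) ^ p))` is continuous for `p ≥ 0`. -/
lemma continuous_exp_neg_mul_log_rpow {E : Type*} [NormedAddCommGroup E] (a : ℝ) {p : ℝ}
    (hp : 0 ≤ p) : Continuous fun z : E => Real.exp (-(a * Real.log (2 + ‖z‖) ^ p)) := by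
  have h : Continuous fun z : E => Real.log (2 + ‖z‖) :=
    (continuous_const.add continuous_norm).log fun z => (add_pos_of_pos_of_nonneg two_pos (norm_nonneg z)).ne'
  exact Real.continuous_exp.comp (continuous_const.mul (h.rpow_const fun _ => Or.inr hp)).neg

/-- For `β > 1`, `d ∈ ℕ`, `c₀ > 0` and `s₀ t = max (exp (t^{-1/(β-1)}) - 2) 2`:
there are `c, c' > 0` such that for all `0 < t ≤ 2`,
`∫_{|z| ≤ s₀(t)} exp (-(c₀ t (log (2+|z|))^β)) dz ≥ c exp (c' t^{-1/(β-1)})`. -/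
theorem stmt_10 (β : ℝ) (hβ : 1 < β) (d : ℕ) (hd : 0 < d)
    (c₀ : ℝ) (hc₀ : 0 < c₀) :
    ∃ c c' : ℝ, 0 < c ∧ 0 < c' ∧ ∀ t : ℝ, 0 < t → t ≤ 2 →
      c * Real.exp (c' * t ^ (-(1 / (β - 1)))) ≤
      ∫ z in {z : EuclideanSpace ℝ (Fin d) |
          ‖z‖ ≤ max (Real.exp (t ^ (-(1 / (β - 1)))) - 2) 2},
        Real.exp (-(c₀ * t * Real.log (2 + ‖z‖) ^ β)) := by
  have hβ1 : 0 < β - 1 := by linarith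
  have hβ0 : 0 ≤ β := by linarith
  obtain ⟨k, hk, hk2, hkK⟩ := exists_mul_rpow_le_half (K := c₀ * 2 ^ β) (by positivity) hβ1
  set V : ℝ := volume.real (Metric.ball (0 : EuclideanSpace ℝ (Fin d)) 1) with hV
  have hVpos : 0 < V :=
    ENNReal.toReal_pos (Metric.measure_ball_pos _ _ one_pos).ne' measure_ball_lt_top.ne
  set A : ℝ := c₀ * 2 * (2 * Real.log 3) ^ β with hA
  have hlog3 : 0 ≤ Real.log 3 := Real.log_nonneg (by norm_num)
  refine ⟨V * Real.exp (-A), k / 2, by positivity, by positivity, fun t ht ht2 => ?_⟩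
  set L : ℝ := t ^ (-(1 / (β - 1))) with hL
  have hLpos : 0 < L := by positivity
  have htL : t * L ^ β = L := by
    have : t = L ^ (-(β - 1)) := by
      rw [hL, ← Real.rpow_mul ht.le]
      have : -(1 / (β - 1)) * -(β - 1) = 1 := by field_simp
      rw [this, Real.rpow_one]
    nth_rewrite 1 [this]
    rw [← Real.rpow_add hLpos]
    have : -(β - 1) + β = 1 := by ring
    rw [this, Real.rpow_one]
  set ρ : ℝ := Real.exp (k * L) with hρ
  have hρ1 : 1 ≤ ρ := Real.one_le_exp (by positivity)
  have hρs : ρ ≤ max (Real.exp L - 2) 2 := by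
    rcases le_total ρ 2 with h | h
    · exact le_max_of_le_right h
    · refine le_max_of_le_left ?_
      have : ρ * ρ ≤ Real.exp L := by
        rw [hρ, ← Real.exp_add]
        exact Real.exp_le_exp.2 (by nlinarith)
      nlinarith
  have hset : {z : EuclideanSpace ℝ (Fin d) | ‖z‖ ≤ max (Real.exp L - 2) 2} =
      Metric.closedBall 0 (max (Real.exp L - 2) 2) := by
    ext z; simp
  have hcont := continuous_exp_neg_mul_log_rpow (E := EuclideanSpace ℝ (Fin d)) (c₀ * t) hβ0
  have hint : ∀ R : ℝ, IntegrableOn (fun z : EuclideanSpace ℝ (Fin d) =>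
      Real.exp (-(c₀ * t * Real.log (2 + ‖z‖) ^ β))) (Metric.closedBall 0 R) := fun R =>
    hcont.continuousOn.integrableOn_compact (isCompact_closedBall _ _)
  have hpt : ∀ z ∈ Metric.closedBall (0 : EuclideanSpace ℝ (Fin d)) ρ,
      Real.exp (-A - k / 2 * L) ≤ Real.exp (-(c₀ * t * Real.log (2 + ‖z‖) ^ β)) := by
    intro z hz
    have hz : ‖z‖ ≤ ρ := by simpa using hz
    have hz0 := norm_nonneg z
    have h1 : Real.log (2 + ‖z‖) ≤ Real.log 3 + k * L := by
      calc Real.log (2 + ‖z‖) ≤ Real.log (3 * ρ) := Real.log_le_log (by positivity) (by linarith)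
        _ = Real.log 3 + k * L := by
          rw [Real.log_mul (by norm_num) (by positivity), hρ, Real.log_exp]
    have h2 : Real.log (2 + ‖z‖) ^ β ≤ (2 * Real.log 3) ^ β + (2 * (k * L)) ^ β :=
      (Real.rpow_le_rpow (Real.log_nonneg (by linarith)) h1 hβ0).trans
        (rpow_add_le_two_mul_rpow hlog3 (by positivity) hβ0)
    have h3 : c₀ * t * (2 * Real.log 3) ^ β ≤ A := by
      rw [hA]; gcongr
    have h4 : c₀ * t * (2 * (k * L)) ^ β ≤ k / 2 * L := by
      have hkβ : k ^ β = k ^ (β - 1) * k := by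
        rw [Real.rpow_sub_one hk.ne']; field_simp
      calc c₀ * t * (2 * (k * L)) ^ β
          = (c₀ * 2 ^ β * k ^ (β - 1)) * (k * (t * L ^ β)) := by
            rw [Real.mul_rpow (by norm_num) (by positivity), Real.mul_rpow hk.le hLpos.le, hkβ]
            ring
        _ ≤ 1 / 2 * (k * (t * L ^ β)) := by gcongr
        _ = k / 2 * L := by rw [htL]; ring
    have h5 : c₀ * t * Real.log (2 + ‖z‖) ^ β ≤
        c₀ * t * ((2 * Real.log 3) ^ β + (2 * (k * L)) ^ β) := by gcongr
    exact Real.exp_le_exp.2 (by linarith)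
  have hvol : volume.real (Metric.closedBall (0 : EuclideanSpace ℝ (Fin d)) ρ) = ρ ^ d * V := by
    rw [Measure.addHaar_real_closedBall _ _ (by positivity), finrank_euclideanSpace_fin]
  rw [hset]
  calc V * Real.exp (-A) * Real.exp (k / 2 * L)
      = Real.exp (-A - k / 2 * L) * (ρ * V) := by
        rw [hρ, mul_assoc, ← Real.exp_add, ← mul_assoc, ← Real.exp_add, mul_comm]
        ring_nf
    _ ≤ Real.exp (-A - k / 2 * L) * (ρ ^ d * V) := by
        gcongr
        exact le_self_pow₀ hρ1 hd.ne'
    _ = ∫ _ in Metric.closedBall (0 : EuclideanSpace ℝ (Fin d)) ρ,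
          Real.exp (-A - k / 2 * L) := by
        rw [setIntegral_const, hvol, smul_eq_mul, mul_comm]
    _ ≤ ∫ z in Metric.closedBall (0 : EuclideanSpace ℝ (Fin d)) ρ,
          Real.exp (-(c₀ * t * Real.log (2 + ‖z‖) ^ β)) :=
        setIntegral_mono_on (integrableOn_const measure_closedBall_lt_top.ne) (hint ρ)
          measurableSet_closedBall hpt
    _ ≤ _ := setIntegral_mono_set (hint _) (Filter.Eventually.of_forall fun _ => by positivity)
        (Metric.closedBall_subset_closedBall hρs).eventuallyLE
end

section
/- Let d∈ℕ, λ₁∈ℝ, T₀>0, and let H:ℝ^d→(0,∞) be measurable. Let p:(0,∞)×ℝ^d×ℝ^d→[0,∞) be measurable and satisfy the Chapman–Kolmogorov identity p(s+t,x,y) = ∫_{ℝ^d} p(s,x,w)·p(t,w,y) dw for all s,t>0 and all x,y∈ℝ^d. Assume there are constants c₃,c₄,c₅,c₆>0 such that (i) c₃·e^{−λ₁t}·H(x) ≤ ∫_{ℝ^d} p(t,x,w)·H(w) dw ≤ c₄·e^{−λ₁t}·H(x) for all t>0 and x∈ℝ^d, and (ii) c₅·H(z)·H(u) ≤ p(T₀,z,u)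 ≤ c₆·H(z)·H(u) for all z,u∈ℝ^d. Then there exist constants C₇,C₈>0 such that for every t>T₀ and all x,y∈ℝ^d: C₇·e^{−λ₁t}·H(x)·H(y) ≤ p(t,x,y) ≤ C₈·e^{−λ₁t}·H(x)·H(y). -/
open MeasureTheory

/-- Let `p` be a nonnegative measurable kernel on `(0,∞) × ℝ^d × ℝ^d` satisfying the
Chapman–Kolmogorov identity, let `H : ℝ^d → (0,∞)` be measurable, and assume
(i) `c₃ e^{-λ₁ t} H x ≤ ∫ p(t,x,w) H w dw ≤ c₄ e^{-λ₁ t} H x` for all `t > 0`, `x`, and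
(ii) `c₅ H z H u ≤ p(T₀,z,u) ≤ c₆ H z H u` for all `z, u`. Then there are `C₇, C₈ > 0`
with `C₇ e^{-λ₁ t} H x H y ≤ p(t,x,y) ≤ C₈ e^{-λ₁ t} H x H y` for all `t > T₀`, `x, y`. -/
theorem stmt_11 (d : ℕ) (hd : 0 < d) (l₁ T₀ : ℝ) (hT₀ : 0 < T₀)
    (H : EuclideanSpace ℝ (Fin d) → ℝ) (hHmeas : Measurable H) (hHpos : ∀ x, 0 < H x)
    (p : ℝ → EuclideanSpace ℝ (Fin d) → EuclideanSpace ℝ (Fin d) → ℝ)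
    (hpmeas : Measurable
      (fun q : ℝ × EuclideanSpace ℝ (Fin d) × EuclideanSpace ℝ (Fin d) =>
        p q.1 q.2.1 q.2.2))
    (hpnonneg : ∀ t : ℝ, 0 < t → ∀ x y, 0 ≤ p t x y)
    (hCK : ∀ s t : ℝ, 0 < s → 0 < t → ∀ x y,
      p (s + t) x y = ∫ w, p s x w * p t w y)
    (c₃ c₄ c₅ c₆ : ℝ) (hc₃ : 0 < c₃) (hc₄ : 0 < c₄) (hc₅ : 0 < c₅) (hc₆ : 0 < c₆)
    (hH1 : ∀ t : ℝ, 0 < t → ∀ x,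
      c₃ * Real.exp (-(l₁ * t)) * H x ≤ ∫ w, p t x w * H w)
    (hH2 : ∀ t : ℝ, 0 < t → ∀ x,
      (∫ w, p t x w * H w) ≤ c₄ * Real.exp (-(l₁ * t)) * H x)
    (hp1 : ∀ z u, c₅ * H z * H u ≤ p T₀ z u)
    (hp2 : ∀ z u, p T₀ z u ≤ c₆ * H z * H u) :
    ∃ C₇ C₈ : ℝ, 0 < C₇ ∧ 0 < C₈ ∧ ∀ t : ℝ, T₀ < t → ∀ x y,
      C₇ * Real.exp (-(l₁ * t)) * H x * H y ≤ p t x y ∧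
        p t x y ≤ C₈ * Real.exp (-(l₁ * t)) * H x * H y := by
  refine ⟨c₃ * c₅ * Real.exp (l₁ * T₀), c₄ * c₆ * Real.exp (l₁ * T₀), by positivity,
    by positivity, fun t ht x y => ?_⟩
  have hs : 0 < t - T₀ := sub_pos.mpr ht
  have hHx := hHpos x
  have hHy := hHpos y
  have hexp : Real.exp (-(l₁ * (t - T₀))) = Real.exp (l₁ * T₀) * Real.exp (-(l₁ * t)) := by
    rw [← Real.exp_add]
    ring_nf
  have hlow := hH1 (t - T₀) hs x
  have hupp := hH2 (t - T₀) hs x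
  have hpH : Integrable (fun w => p (t - T₀) x w * H w) := by
    by_contra h
    rw [integral_undef h] at hlow
    exact absurd hlow (not_le.mpr (by positivity))
  have hpp : Integrable (fun w => p (t - T₀) x w * p T₀ w y) := by
    refine (hpH.mul_const (c₆ * H y)).mono' (Measurable.aestronglyMeasurable ?_)
      (.of_forall fun w => ?_)
    · exact (hpmeas.comp (g := fun q => p q.1 q.2.1 q.2.2) (f := fun w => (t - T₀, x, w))
        (by fun_prop)).mul
        (hpmeas.comp (g := fun q => p q.1 q.2.1 q.2.2) (f := fun w => (T₀, w, y)) (by fun_prop))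
    · rw [Real.norm_of_nonneg (mul_nonneg (hpnonneg _ hs _ _) (hpnonneg _ hT₀ _ _))]
      calc p (t - T₀) x w * p T₀ w y ≤ p (t - T₀) x w * (c₆ * H w * H y) :=
            mul_le_mul_of_nonneg_left (hp2 w y) (hpnonneg _ hs _ _)
        _ = p (t - T₀) x w * H w * (c₆ * H y) := by ring
  have hsplit : p t x y = ∫ w, p (t - T₀) x w * p T₀ w y := by
    rw [← hCK _ _ hs hT₀, sub_add_cancel]
  rw [hexp] at hlow hupp
  rw [hsplit]
  constructor
  · calc c₃ * c₅ * Real.exp (l₁ * T₀) * Real.exp (-(l₁ * t)) * H x * H y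
        = c₃ * (Real.exp (l₁ * T₀) * Real.exp (-(l₁ * t))) * H x * (c₅ * H y) := by ring
      _ ≤ (∫ w, p (t - T₀) x w * H w) * (c₅ * H y) := by gcongr
      _ = ∫ w, p (t - T₀) x w * H w * (c₅ * H y) := (integral_mul_const _ _).symm
      _ ≤ ∫ w, p (t - T₀) x w * p T₀ w y := by
        refine integral_mono (hpH.mul_const _) hpp fun w => ?_
        have := mul_le_mul_of_nonneg_left (hp1 w y) (hpnonneg _ hs x w)
        linarith
  · calc ∫ w, p (t - T₀) x w * p T₀ w y
        ≤ ∫ w, p (t - T₀) x w * H w * (c₆ * H y) := by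
            refine integral_mono hpp (hpH.mul_const _) fun w => ?_
            have := mul_le_mul_of_nonneg_left (hp2 w y) (hpnonneg _ hs x w)
            linarith
      _ = (∫ w, p (t - T₀) x w * H w) * (c₆ * H y) := integral_mul_const _ _
      _ ≤ c₄ * (Real.exp (l₁ * T₀) * Real.exp (-(l₁ * t))) * H x * (c₆ * H y) := by gcongr
      _ = c₄ * c₆ * Real.exp (l₁ * T₀) * Real.exp (-(l₁ * t)) * H x * H y := by ring
end

section
/- Let d∈ℕ, α>0 and c>0. There exist constants C₁,C₂>0, depending only on d, α and c, such that for all a>0, r>0 and T ≥ 2·r^α: C₁·r^{−d}·exp(−2c·r^α·a) ≤ ∫_{r^α}^{T} t^{−d/α−1}·exp(−c·t·a) dt ≤ C₂·r^{−d}·exp(−c·r^α·a). -/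
open MeasureTheory

theorem integral_rpow_neg_sub_one {p s T : ℝ} (hp : 0 < p) (hs : 0 < s) (hsT : s ≤ T) :
    ∫ t in s..T, t ^ (-p - 1) = (s ^ (-p) - T ^ (-p)) / p := by
  rw [integral_rpow (Or.inr ⟨by linarith, Set.notMem_uIcc_of_lt hs (hs.trans_le hsT)⟩),
    sub_add_cancel, div_neg, ← neg_div, neg_sub]

theorem intervalIntegrable_rpow_mul_exp_neg (q b : ℝ) {s T : ℝ} (hs : 0 < s) (hsT : s ≤ T) :
    IntervalIntegrable (fun t : ℝ => t ^ q * Real.exp (-(b * t))) volume s T := by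
  refine ((intervalIntegral.intervalIntegrable_rpow
    (Or.inr (Set.notMem_uIcc_of_lt hs (hs.trans_le hsT)))).mul_continuousOn ?_)
  fun_prop

theorem integral_rpow_mul_exp_neg_le {p b s T : ℝ} (hp : 0 < p) (hb : 0 ≤ b) (hs : 0 < s)
    (hsT : s ≤ T) :
    ∫ t in s..T, t ^ (-p - 1) * Real.exp (-(b * t)) ≤
      (s ^ (-p) - T ^ (-p)) / p * Real.exp (-(b * s)) := by
  rw [← integral_rpow_neg_sub_one hp hs hsT, ← intervalIntegral.integral_mul_const]
  refine intervalIntegral.integral_mono_on hsT (intervalIntegrable_rpow_mul_exp_neg _ b hs hsT)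
    ((intervalIntegral.intervalIntegrable_rpow
      (Or.inr (Set.notMem_uIcc_of_lt hs (hs.trans_le hsT)))).mul_const _) fun t ht => ?_
  have : 0 < t := hs.trans_le ht.1
  have := ht.1
  gcongr

theorem le_integral_rpow_mul_exp_neg {p b s T : ℝ} (hp : 0 < p) (hb : 0 ≤ b) (hs : 0 < s)
    (hsT : s ≤ T) :
    (s ^ (-p) - T ^ (-p)) / p * Real.exp (-(b * T)) ≤
      ∫ t in s..T, t ^ (-p - 1) * Real.exp (-(b * t)) := by
  rw [← integral_rpow_neg_sub_one hp hs hsT, ← intervalIntegral.integral_mul_const]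
  refine intervalIntegral.integral_mono_on hsT
    ((intervalIntegral.intervalIntegrable_rpow
      (Or.inr (Set.notMem_uIcc_of_lt hs (hs.trans_le hsT)))).mul_const _)
    (intervalIntegrable_rpow_mul_exp_neg _ b hs hsT) fun t ht => ?_
  have : 0 < t := hs.trans_le ht.1
  have := ht.2
  gcongr

/-- For `d ∈ ℕ`, `α > 0` and `c > 0` there are constants `C₁, C₂ > 0` such that for all
`a > 0`, `r > 0` and `T ≥ 2 r^α`:
`C₁ r^{-d} e^{-2c r^α a} ≤ ∫_{r^α}^T t^{-d/α-1} e^{-c t a} dt ≤ C₂ r^{-d} e^{-c r^α a}`. -/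
theorem stmt_12 (d : ℕ) (hd : 0 < d) (α : ℝ) (hα : 0 < α) (c : ℝ) (hc : 0 < c) :
    ∃ C₁ C₂ : ℝ, 0 < C₁ ∧ 0 < C₂ ∧ ∀ a r T : ℝ, 0 < a → 0 < r → 2 * r ^ α ≤ T →
      C₁ * r ^ (-(d : ℝ)) * Real.exp (-(2 * c * r ^ α * a)) ≤
        (∫ t in (r ^ α)..T, t ^ (-(d : ℝ) / α - 1) * Real.exp (-(c * t * a))) ∧
      (∫ t in (r ^ α)..T, t ^ (-(d : ℝ) / α - 1) * Real.exp (-(c * t * a))) ≤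
        C₂ * r ^ (-(d : ℝ)) * Real.exp (-(c * r ^ α * a)) := by
  have hp : 0 < (d : ℝ) / α := div_pos (Nat.cast_pos.2 hd) hα
  have h2 : (2 : ℝ) ^ (-((d : ℝ) / α)) < 1 :=
    Real.rpow_lt_one_of_one_lt_of_neg one_lt_two (neg_lt_zero.2 hp)
  refine ⟨(1 - 2 ^ (-((d : ℝ) / α))) / (d / α), 1 / (d / α), div_pos (sub_pos.2 h2) hp,
    one_div_pos.2 hp, fun a r T ha hr hT => ?_⟩
  have hs : 0 < r ^ α := Real.rpow_pos_of_pos hr α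
  have hrs : r ^ (-(d : ℝ)) = (r ^ α) ^ (-((d : ℝ) / α)) := by
    rw [← Real.rpow_mul hr.le, mul_neg, mul_div_cancel₀ _ hα.ne']
  have hint : ∀ t : ℝ, t ^ (-(d : ℝ) / α - 1) * Real.exp (-(c * t * a)) =
      t ^ (-((d : ℝ) / α) - 1) * Real.exp (-(c * a * t)) := fun t => by
    rw [neg_div, mul_right_comm]
  simp only [hint, hrs]
  generalize (d : ℝ) / α = p at *
  generalize r ^ α = s at *
  have hb : 0 ≤ c * a := by positivity
  have hs2 : s ≤ 2 * s := by linarith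
  constructor
  · calc (1 - 2 ^ (-p)) / p * s ^ (-p) * Real.exp (-(2 * c * s * a))
        = (s ^ (-p) - (2 * s) ^ (-p)) / p * Real.exp (-(c * a * (2 * s))) := by
          rw [Real.mul_rpow zero_le_two hs.le]
          ring_nf
      _ ≤ ∫ t in s..2 * s, t ^ (-p - 1) * Real.exp (-(c * a * t)) :=
          le_integral_rpow_mul_exp_neg hp hb hs hs2
      _ ≤ ∫ t in s..T, t ^ (-p - 1) * Real.exp (-(c * a * t)) := by
          refine intervalIntegral.integral_mono_interval le_rfl hs2 hT ?_
            (intervalIntegrable_rpow_mul_exp_neg _ _ hs (hs2.trans hT))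
          filter_upwards [ae_restrict_mem measurableSet_Ioc] with t ht
          have : 0 < t := hs.trans ht.1
          simp only [Pi.zero_apply]
          positivity
  · calc ∫ t in s..T, t ^ (-p - 1) * Real.exp (-(c * a * t))
        ≤ (s ^ (-p) - T ^ (-p)) / p * Real.exp (-(c * a * s)) :=
          integral_rpow_mul_exp_neg_le hp hb hs (hs2.trans hT)
      _ ≤ s ^ (-p) / p * Real.exp (-(c * a * s)) := by
          gcongr
          exact sub_le_self _ (Real.rpow_nonneg (hs.le.trans (hs2.trans hT)) _)
      _ = 1 / p * s ^ (-p) * Real.exp (-(c * s * a)) := by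
          ring_nf
end

section
/- Let d∈ℕ, α∈(0,2) and c>0. Define Q(a,r) := 1 if α<d; Q(a,r) := max{log(1/(r^α·a)), 1} if α=d=1; and Q(a,r) := (r^α·a)^{−(α−d)/α} if α>d=1. Then there exists a constant C≥1 such that for all a≥1, r>0 and T>0 satisfying r^α·a ≤ 2, T ≥ 2·r^α and T·a ≥ 4: C^{−1}·r^{α−d}·Q(a,r) ≤ ∫_{r^α/2}^{T} t^{−d/α}·exp(−c·t·a) dt ≤ C·r^{α−d}·Q(a,r). -/
open MeasureTheory

/-- The profile `Q(a,r)`: equal to `1` when `α < d`, to `max (log (1/(r^α a))) 1` when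
`α = d` (necessarily `d = 1` since `α < 2`), and to `(r^α a)^{-(α-d)/α}` when `α > d`
(necessarily `d = 1`). -/
noncomputable def Q13 (d : ℕ) (α a r : ℝ) : ℝ :=
  if α < d then 1
  else if α = d then max (Real.log (1 / (r ^ α * a))) 1
  else (r ^ α * a) ^ (-((α - d) / α))

lemma intervalIntegrable_rpow_of_pos {x y : ℝ} (hx : 0 < x) (hxy : x ≤ y) (p : ℝ) :
    IntervalIntegrable (fun t : ℝ => t ^ p) volume x y := by
  refine intervalIntegral.intervalIntegrable_rpow (Or.inr ?_)
  rw [Set.uIcc_of_le hxy]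
  exact fun h => hx.not_ge h.1

lemma intervalIntegrable_rpow_mul_exp {x y : ℝ} (hx : 0 < x) (hxy : x ≤ y) (p k : ℝ) :
    IntervalIntegrable (fun t : ℝ => t ^ p * Real.exp (-(k * t))) volume x y :=
  (intervalIntegrable_rpow_of_pos hx hxy p).mul_continuousOn (by fun_prop)

/-- Truncating at `4 / u`, where the exponential is still at least `exp (-4c)`. -/
lemma exp_mul_integral_rpow_le {p c u L : ℝ} (hc : 0 < c) (hu : 0 < u) (hu2 : u ≤ 2)
    (hL : 4 / u ≤ L) :
    Real.exp (-(4 * c)) * (∫ x in (1 / 2 : ℝ)..(4 / u), x ^ (-p)) ≤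
      ∫ x in (1 / 2 : ℝ)..L, x ^ (-p) * Real.exp (-(c * u * x)) := by
  have hM : (2 : ℝ) ≤ 4 / u := by rw [le_div_iff₀ hu]; linarith
  have h0 : (0 : ℝ) < 1 / 2 := by norm_num
  calc Real.exp (-(4 * c)) * (∫ x in (1 / 2 : ℝ)..(4 / u), x ^ (-p))
      = ∫ x in (1 / 2 : ℝ)..(4 / u), Real.exp (-(4 * c)) * x ^ (-p) := by
        rw [intervalIntegral.integral_const_mul]
    _ ≤ ∫ x in (1 / 2 : ℝ)..(4 / u), x ^ (-p) * Real.exp (-(c * u * x)) := by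
        refine intervalIntegral.integral_mono_on (by linarith)
          ((intervalIntegrable_rpow_of_pos h0 (by linarith) _).const_mul _)
          (intervalIntegrable_rpow_mul_exp h0 (by linarith) _ _) fun x hx => ?_
        have hx0 : 0 < x := h0.trans_le hx.1
        have hux : x * u ≤ 4 := (le_div_iff₀ hu).1 hx.2
        rw [mul_comm]
        gcongr _ * Real.exp ?_
        nlinarith
    _ ≤ _ := by
        refine intervalIntegral.integral_mono_interval le_rfl (by linarith) hL ?_
          (intervalIntegrable_rpow_mul_exp h0 (by linarith) _ _)
        filter_upwards [ae_restrict_mem measurableSet_Ioc] with x hx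
        have hx0 : 0 < x := h0.trans hx.1
        simp only [Pi.zero_apply]
        positivity

/-- Splitting at `4 / u`; beyond that point the exponential decay takes over. -/
lemma integral_rpow_mul_exp_le {p c u L : ℝ} (hp : 0 < p) (hc : 0 < c) (hu : 0 < u)
    (hu2 : u ≤ 2) (hL : 4 / u ≤ L) :
    (∫ x in (1 / 2 : ℝ)..L, x ^ (-p) * Real.exp (-(c * u * x))) ≤
      (∫ x in (1 / 2 : ℝ)..(4 / u), x ^ (-p)) + u ^ (p - 1) / c := by
  have hM : (2 : ℝ) ≤ 4 / u := by rw [le_div_iff₀ hu]; linarith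
  have h0 : (0 : ℝ) < 1 / 2 := by norm_num
  rw [← intervalIntegral.integral_add_adjacent_intervals
    (intervalIntegrable_rpow_mul_exp h0 (by linarith : 1 / 2 ≤ 4 / u) _ _)
    (intervalIntegrable_rpow_mul_exp (by linarith) hL _ _)]
  refine add_le_add ?_ ?_
  · refine intervalIntegral.integral_mono_on (by linarith)
      (intervalIntegrable_rpow_mul_exp h0 (by linarith) _ _)
      (intervalIntegrable_rpow_of_pos h0 (by linarith) _) fun x hx => ?_
    have hx0 : 0 < x := h0.trans_le hx.1
    refine mul_le_of_le_one_right (by positivity) (Real.exp_le_one_iff.2 ?_)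
    have : 0 < c * u * x := by positivity
    linarith
  · have hcu : c * u ≠ 0 := by positivity
    calc (∫ x in (4 / u)..L, x ^ (-p) * Real.exp (-(c * u * x)))
        ≤ ∫ x in (4 / u)..L, (1 / u) ^ (-p) * Real.exp (-(c * u) * x) := by
          refine intervalIntegral.integral_mono_on hL
            (intervalIntegrable_rpow_mul_exp (by linarith) hL _ _)
            (Continuous.intervalIntegrable (by fun_prop) _ _) fun x hx => ?_
          have h1 : (1 / u) ≤ x := by
            refine le_trans ?_ hx.1
            gcongr
            norm_num
          rw [neg_mul]
          exact mul_le_mul_of_nonneg_right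
            (Real.rpow_le_rpow_of_nonpos (by positivity) h1 (by linarith))
            (Real.exp_pos _).le
      _ = (1 / u) ^ (-p) *
            ((Real.exp (-(c * u) * (4 / u)) - Real.exp (-(c * u) * L)) / (c * u)) := by
          rw [intervalIntegral.integral_const_mul,
            intervalIntegral.integral_comp_mul_left _ (neg_ne_zero.2 hcu), integral_exp,
            smul_eq_mul]
          congr 1
          field_simp
          ring
      _ ≤ (1 / u) ^ (-p) * (1 / (c * u)) := by
          have h1 : Real.exp (-(c * u) * (4 / u)) ≤ 1 := by
            rw [Real.exp_le_one_iff]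
            have : 0 < c * u * (4 / u) := by positivity
            linarith
          have h2 := Real.exp_pos (-(c * u) * L)
          gcongr
          linarith
      _ = u ^ (p - 1) / c := by
          rw [one_div u, Real.inv_rpow hu.le, Real.rpow_neg hu.le, inv_inv,
            Real.rpow_sub_one hu.ne']
          field_simp

/-- The profile `Q13`, in terms of `p = d / α` and `u = r ^ α * a`. -/
noncomputable def scaledProfile (p u : ℝ) : ℝ :=
  if 1 < p then 1 else if p = 1 then max (Real.log (1 / u)) 1 else u ^ (p - 1)

lemma scaledProfile_nonneg {p u : ℝ} (hu : 0 < u) : 0 ≤ scaledProfile p u := by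
  unfold scaledProfile
  split_ifs
  · exact zero_le_one
  · exact zero_le_one.trans (le_max_right _ _)
  · positivity

lemma rpow_sub_one_le_mul_scaledProfile {p u : ℝ} (hp : 0 < p) (hu : 0 < u) (hu2 : u ≤ 2) :
    u ^ (p - 1) ≤ 2 ^ p * scaledProfile p u := by
  have h2 : (1 : ℝ) ≤ 2 ^ p := Real.one_le_rpow (by norm_num) hp.le
  unfold scaledProfile
  split_ifs with h h'
  · calc u ^ (p - 1) ≤ 2 ^ (p - 1) := Real.rpow_le_rpow hu.le hu2 (by linarith)
      _ ≤ 2 ^ p := Real.rpow_le_rpow_of_exponent_le (by norm_num) (by linarith)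
      _ = _ := by ring
  · have := le_max_right (Real.log (1 / u)) 1
    rw [h', sub_self, Real.rpow_zero]
    rw [h'] at h2
    nlinarith
  · have : 0 ≤ u ^ (p - 1) := by positivity
    nlinarith

lemma integral_rpow_comparable_scaledProfile (p : ℝ) :
    ∃ A B : ℝ, 0 < A ∧ 0 < B ∧ ∀ u : ℝ, 0 < u → u ≤ 2 →
      A * scaledProfile p u ≤ (∫ x in (1 / 2 : ℝ)..(4 / u), x ^ (-p)) ∧
      (∫ x in (1 / 2 : ℝ)..(4 / u), x ^ (-p)) ≤ B * scaledProfile p u := by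
  have h0 : (0 : ℝ) < 1 / 2 := by norm_num
  have hM {u : ℝ} (hu : 0 < u) (hu2 : u ≤ 2) : (2 : ℝ) ≤ 4 / u := by
    rw [le_div_iff₀ hu]; linarith
  have key {u : ℝ} (hu : 0 < u) (hu2 : u ≤ 2) (hp : p ≠ 1) :
      (∫ x in (1 / 2 : ℝ)..(4 / u), x ^ (-p)) =
        ((4 / u) ^ (1 - p) - (1 / 2) ^ (1 - p)) / (1 - p) := by
    rw [integral_rpow, neg_add_eq_sub]
    refine Or.inr ⟨fun h => hp (by linarith), ?_⟩
    rw [Set.uIcc_of_le (by linarith [hM hu hu2])]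
    exact fun h => h0.not_ge h.1
  rcases lt_trichotomy 1 p with hp | rfl | hp
  · have hlt : (2 : ℝ) ^ (1 - p) < (1 / 2) ^ (1 - p) :=
      Real.rpow_lt_rpow_of_neg h0 (by norm_num) (by linarith)
    have hp' : 0 < p - 1 := by linarith
    refine ⟨((1 / 2) ^ (1 - p) - 2 ^ (1 - p)) / (p - 1), (1 / 2) ^ (1 - p) / (p - 1),
      div_pos (by linarith) hp', by positivity, fun u hu hu2 => ?_⟩
    have hle : (4 / u) ^ (1 - p) ≤ 2 ^ (1 - p) :=
      Real.rpow_le_rpow_of_nonpos (by norm_num) (hM hu hu2) (by linarith)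
    have hpos : 0 < (4 / u) ^ (1 - p) := by positivity
    have e : ((4 / u) ^ (1 - p) - (1 / 2) ^ (1 - p)) / (1 - p) =
        ((1 / 2) ^ (1 - p) - (4 / u) ^ (1 - p)) / (p - 1) := by
      rw [← neg_div_neg_eq, neg_sub, neg_sub]
    rw [key hu hu2 hp.ne', e, scaledProfile, if_pos hp, mul_one, mul_one]
    constructor <;> gcongr
    linarith
  · refine ⟨1, 1 + Real.log 8, one_pos, by positivity, fun u hu hu2 => ?_⟩
    have e : (∫ x in (1 / 2 : ℝ)..(4 / u), x ^ (-1 : ℝ)) = Real.log 8 + Real.log (1 / u) := by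
      simp_rw [Real.rpow_neg_one]
      rw [integral_inv_of_pos h0 (by positivity), ← Real.log_mul (by norm_num) (by positivity)]
      congr 1
      field_simp
      norm_num
    have hlog2 := Real.log_two_gt_d9
    have h8 : Real.log 8 = 3 * Real.log 2 := by
      rw [show (8 : ℝ) = 2 ^ (3 : ℕ) by norm_num, Real.log_pow]; norm_num
    have hu' : -Real.log 2 ≤ Real.log (1 / u) := by
      rw [one_div, Real.log_inv]
      linarith [Real.log_le_log hu hu2]
    rw [e, scaledProfile, if_neg (lt_irrefl _), if_pos rfl]
    refine ⟨?_, ?_⟩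
    · rw [one_mul]
      exact max_le (by linarith) (by linarith)
    · have h1 := le_max_left (Real.log (1 / u)) 1
      have h2 := le_max_right (Real.log (1 / u)) 1
      nlinarith
  · have hp' : 0 < 1 - p := by linarith
    have hlt : (1 / 4 : ℝ) ^ (1 - p) < 1 := Real.rpow_lt_one (by norm_num) (by norm_num) hp'
    refine ⟨4 ^ (1 - p) * (1 - (1 / 4) ^ (1 - p)) / (1 - p), 4 ^ (1 - p) / (1 - p),
      div_pos (mul_pos (by positivity) (by linarith)) hp', by positivity, fun u hu hu2 => ?_⟩
    have hpow : (4 / u) ^ (1 - p) = 4 ^ (1 - p) * u ^ (p - 1) := by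
      rw [Real.div_rpow (by norm_num) hu.le, div_eq_mul_inv, ← Real.rpow_neg hu.le, neg_sub]
    have hle : (1 / 2 : ℝ) ^ (1 - p) ≤ (1 / 4) ^ (1 - p) * (4 / u) ^ (1 - p) := by
      rw [← Real.mul_rpow (by norm_num) (by positivity)]
      exact Real.rpow_le_rpow h0.le (by linarith [hM hu hu2]) hp'.le
    have hpos : (0 : ℝ) < (1 / 2) ^ (1 - p) := by positivity
    rw [key hu hu2 hp.ne, scaledProfile, if_neg hp.not_gt, if_neg hp.ne, div_mul_eq_mul_div,
      div_mul_eq_mul_div]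
    constructor <;> gcongr
    · rw [hpow] at hle ⊢
      linarith
    · linarith

lemma integral_rpow_mul_exp_comparable {p c : ℝ} (hp : 0 < p) (hc : 0 < c) :
    ∃ C : ℝ, 1 ≤ C ∧ ∀ u L : ℝ, 0 < u → u ≤ 2 → 4 / u ≤ L →
      C⁻¹ * scaledProfile p u ≤ (∫ x in (1 / 2 : ℝ)..L, x ^ (-p) * Real.exp (-(c * u * x))) ∧
      (∫ x in (1 / 2 : ℝ)..L, x ^ (-p) * Real.exp (-(c * u * x))) ≤ C * scaledProfile p u := by
  obtain ⟨A, B, hA, hB, h⟩ := integral_rpow_comparable_scaledProfile p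
  have hA' : 0 < Real.exp (-(4 * c)) * A := by positivity
  refine ⟨max 1 (max (Real.exp (-(4 * c)) * A)⁻¹ (B + 2 ^ p / c)), le_max_left _ _,
    fun u L hu hu2 hL => ?_⟩
  have hK := scaledProfile_nonneg (p := p) hu
  obtain ⟨h1, h2⟩ := h u hu hu2
  constructor
  · calc _ ≤ (Real.exp (-(4 * c)) * A) * scaledProfile p u := by
          refine mul_le_mul_of_nonneg_right (inv_le_of_inv_le₀ hA' ?_) hK
          exact (le_max_left _ _).trans (le_max_right _ _)
      _ = Real.exp (-(4 * c)) * (A * scaledProfile p u) := by ring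
      _ ≤ _ := (mul_le_mul_of_nonneg_left h1 (Real.exp_pos _).le).trans
          (exp_mul_integral_rpow_le hc hu hu2 hL)
  · calc _ ≤ _ := integral_rpow_mul_exp_le hp hc hu hu2 hL
      _ ≤ B * scaledProfile p u + 2 ^ p * scaledProfile p u / c := by
          gcongr
          exact rpow_sub_one_le_mul_scaledProfile hp hu hu2
      _ = (B + 2 ^ p / c) * scaledProfile p u := by ring
      _ ≤ _ := by
          refine mul_le_mul_of_nonneg_right ?_ hK
          exact (le_max_right _ _).trans (le_max_right _ _)

lemma Q13_eq_scaledProfile (d : ℕ) {α : ℝ} (hα : 0 < α) (a r : ℝ) :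
    Q13 d α a r = scaledProfile (d / α) (r ^ α * a) := by
  have h1 : 1 < (d : ℝ) / α ↔ α < d := one_lt_div hα
  have h2 : (d : ℝ) / α = 1 ↔ α = d := by rw [div_eq_one_iff_eq hα.ne', eq_comm]
  have h3 : -((α - d) / α) = (d : ℝ) / α - 1 := by field_simp; ring
  simp only [Q13, scaledProfile, h1, h2, h3]

/-- Rescaling the integral by `t = s * x`. -/
lemma integral_rpow_mul_exp_scale {s : ℝ} (hs : 0 < s) (p c a : ℝ) {T : ℝ} (hT : s / 2 ≤ T) :
    (∫ t in (s / 2)..T, t ^ (-p) * Real.exp (-(c * t * a))) =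
      s ^ (1 - p) *
        ∫ x in (1 / 2 : ℝ)..(T / s), x ^ (-p) * Real.exp (-(c * (s * a) * x)) := by
  have hle : 1 / 2 ≤ T / s := by rw [le_div_iff₀ hs]; linarith
  have e1 : s / 2 = s * (1 / 2) := by ring
  have e2 : T = s * (T / s) := by field_simp
  conv_lhs => rw [e1, e2]
  rw [← intervalIntegral.mul_integral_comp_mul_left, ← intervalIntegral.integral_const_mul,
    ← intervalIntegral.integral_const_mul]
  refine intervalIntegral.integral_congr fun x hx => ?_
  rw [Set.uIcc_of_le hle] at hx
  have hx0 : 0 ≤ x := by linarith [hx.1]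
  rw [Real.mul_rpow hs.le hx0, sub_eq_add_neg, Real.rpow_add hs, Real.rpow_one,
    show c * (s * x) * a = c * (s * a) * x by ring]
  ring

/-- For `d ∈ ℕ`, `α ∈ (0,2)` and `c > 0` there is `C ≥ 1` such that for all `a ≥ 1`,
`r > 0`, `T > 0` with `r^α a ≤ 2`, `T ≥ 2 r^α` and `T a ≥ 4`:
`C⁻¹ r^{α-d} Q(a,r) ≤ ∫_{r^α/2}^T t^{-d/α} e^{-c t a} dt ≤ C r^{α-d} Q(a,r)`. -/
theorem stmt_13 (d : ℕ) (hd : 0 < d) (α : ℝ) (hα1 : 0 < α) (hα2 : α < 2)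
    (c : ℝ) (hc : 0 < c) :
    ∃ C : ℝ, 1 ≤ C ∧ ∀ a r T : ℝ, 1 ≤ a → 0 < r → 0 < T →
      r ^ α * a ≤ 2 → 2 * r ^ α ≤ T → 4 ≤ T * a →
      C⁻¹ * r ^ (α - (d : ℝ)) * Q13 d α a r ≤
        (∫ t in (r ^ α / 2)..T, t ^ (-(d : ℝ) / α) * Real.exp (-(c * t * a))) ∧
      (∫ t in (r ^ α / 2)..T, t ^ (-(d : ℝ) / α) * Real.exp (-(c * t * a))) ≤
        C * r ^ (α - (d : ℝ)) * Q13 d α a r := by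
  have hp : 0 < (d : ℝ) / α := div_pos (Nat.cast_pos.2 hd) hα1
  obtain ⟨C, hC, h⟩ := integral_rpow_mul_exp_comparable hp hc
  refine ⟨C, hC, fun a r T ha hr hT hra hrT hTa => ?_⟩
  have hs : 0 < r ^ α := by positivity
  have ha0 : 0 < a := one_pos.trans_le ha
  have hL : 4 / (r ^ α * a) ≤ T / r ^ α := by
    rw [div_le_div_iff₀ (by positivity) hs]
    nlinarith
  obtain ⟨h1, h2⟩ := h (r ^ α * a) (T / r ^ α) (by positivity) hra hL
  have hpow : r ^ (α - (d : ℝ)) = (r ^ α) ^ (1 - (d : ℝ) / α) := by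
    rw [← Real.rpow_mul hr.le]
    congr 1
    field_simp
  have hpos : 0 ≤ (r ^ α) ^ (1 - (d : ℝ) / α) := by positivity
  rw [neg_div, integral_rpow_mul_exp_scale hs _ c a (by linarith), hpow,
    Q13_eq_scaledProfile d hα1]
  exact ⟨by linarith [mul_le_mul_of_nonneg_left h1 hpos],
    by linarith [mul_le_mul_of_nonneg_left h2 hpos]⟩
end

section
/- Let α∈(0,2) and c₀>0. There exists a constant C>0 such that for all t>0 and all s with 0<s≤t, setting R = c₀·t^{1/α} and ρ = (c₀/4)·s^{1/α}: ∫_{ρ}^{R−ρ} r^{−1−α}·(R−r)^{−α} dr ≤ C/(t·s). -/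
open MeasureTheory

/-- At least one of `r` and `R - r` is `≥ R / 2`, so that its power `-α` is at most `(R / 2) ^ (-α)`. -/
lemma rpow_mul_sub_rpow_le {α R r : ℝ} (hα : 0 < α) (hr : 0 < r) (hrR : 0 < R - r) :
    r ^ (-1 - α) * (R - r) ^ (-α) ≤
      (R / 2) ^ (-α) * (r ^ (-1 - α) + (R - r) ^ (-1 - α)) := by
  have hR : 0 < R / 2 := by linarith
  rcases le_total r (R / 2) with h | h
  · have h1 : (R - r) ^ (-α) ≤ (R / 2) ^ (-α) :=
      Real.rpow_le_rpow_of_nonpos hR (by linarith) (by linarith)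
    calc r ^ (-1 - α) * (R - r) ^ (-α) ≤ r ^ (-1 - α) * (R / 2) ^ (-α) := by gcongr
      _ = (R / 2) ^ (-α) * r ^ (-1 - α) := mul_comm _ _
      _ ≤ _ := by
        gcongr
        exact le_add_of_nonneg_right (by positivity)
  · have h1 : r ^ (-α) ≤ (R / 2) ^ (-α) :=
      Real.rpow_le_rpow_of_nonpos hR h (by linarith)
    have h2 : r ^ (-1 : ℝ) ≤ (R - r) ^ (-1 : ℝ) :=
      Real.rpow_le_rpow_of_nonpos hrR (by linarith) (by norm_num)
    have split {x : ℝ} (hx : 0 < x) : x ^ (-1 - α) = x ^ (-1 : ℝ) * x ^ (-α) := by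
      rw [← Real.rpow_add hx, sub_eq_add_neg]
    calc r ^ (-1 - α) * (R - r) ^ (-α) = r ^ (-1 : ℝ) * r ^ (-α) * (R - r) ^ (-α) := by
          rw [split hr]
      _ ≤ (R - r) ^ (-1 : ℝ) * (R / 2) ^ (-α) * (R - r) ^ (-α) := by gcongr
      _ = (R / 2) ^ (-α) * (R - r) ^ (-1 - α) := by rw [split hrR]; ring
      _ ≤ _ := by
        gcongr
        exact le_add_of_nonneg_left (by positivity)

lemma intervalIntegral_rpow_neg_one_sub_le {α a b : ℝ} (hα : 0 < α) (ha : 0 < a) (hab : a ≤ b) :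
    ∫ r in a..b, r ^ (-1 - α) ≤ a ^ (-α) / α := by
  have h0 : (0 : ℝ) ∉ Set.uIcc a b := Set.notMem_uIcc_of_lt ha (ha.trans_le hab)
  rw [integral_rpow (Or.inr ⟨by linarith, h0⟩), show -1 - α + 1 = -α by ring, div_neg,
    ← neg_div, neg_sub]
  have := Real.rpow_nonneg (ha.le.trans hab) (-α)
  gcongr
  linarith

lemma intervalIntegral_rpow_mul_sub_rpow_le {α R ρ : ℝ} (hα : 0 < α) (hρ : 0 < ρ)
    (hρR : ρ ≤ R - ρ) :
    ∫ r in ρ..(R - ρ), r ^ (-1 - α) * (R - r) ^ (-α) ≤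
      2 / α * ((R / 2) ^ (-α) * ρ ^ (-α)) := by
  have hpos {r : ℝ} (hr : r ∈ Set.uIcc ρ (R - ρ)) : 0 < r ∧ 0 < R - r := by
    rw [Set.uIcc_of_le hρR] at hr
    exact ⟨hρ.trans_le hr.1, by linarith [hr.2]⟩
  have hc (p : ℝ) : ContinuousOn (fun r : ℝ => r ^ p) (Set.uIcc ρ (R - ρ)) :=
    continuousOn_id.rpow_const fun r hr => Or.inl (hpos hr).1.ne'
  have hc' (p : ℝ) : ContinuousOn (fun r : ℝ => (R - r) ^ p) (Set.uIcc ρ (R - ρ)) :=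
    (continuousOn_const.sub continuousOn_id).rpow_const fun r hr => Or.inl (hpos hr).2.ne'
  have hI := intervalIntegral_rpow_neg_one_sub_le hα hρ hρR
  have hsymm : ∫ r in ρ..(R - ρ), (R - r) ^ (-1 - α) = ∫ r in ρ..(R - ρ), r ^ (-1 - α) := by
    rw [intervalIntegral.integral_comp_sub_left (fun r : ℝ => r ^ (-1 - α)) R, sub_sub_cancel]
  have hR : 0 ≤ R / 2 := by linarith
  calc ∫ r in ρ..(R - ρ), r ^ (-1 - α) * (R - r) ^ (-α)
      ≤ ∫ r in ρ..(R - ρ), (R / 2) ^ (-α) * (r ^ (-1 - α) + (R - r) ^ (-1 - α)) :=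
        intervalIntegral.integral_mono_on hρR ((hc _).mul (hc' _)).intervalIntegrable
          (continuousOn_const.mul ((hc _).add (hc' _))).intervalIntegrable fun r hr => by
            have h := hpos (Set.Icc_subset_uIcc hr)
            exact rpow_mul_sub_rpow_le hα h.1 h.2
    _ = (R / 2) ^ (-α) * (2 * ∫ r in ρ..(R - ρ), r ^ (-1 - α)) := by
        rw [intervalIntegral.integral_const_mul, intervalIntegral.integral_add
          (hc _).intervalIntegrable (hc' _).intervalIntegrable, hsymm, two_mul]
    _ ≤ (R / 2) ^ (-α) * (2 * (ρ ^ (-α) / α)) := by gcongr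
    _ = _ := by ring

/-- For `α ∈ (0,2)` and `c₀ > 0` there is `C > 0` such that for all `0 < s ≤ t`, with
`R = c₀ t^{1/α}` and `ρ = (c₀/4) s^{1/α}`:
`∫_ρ^{R-ρ} r^{-1-α} (R-r)^{-α} dr ≤ C / (t s)`. -/
theorem stmt_14 (α : ℝ) (hα1 : 0 < α) (hα2 : α < 2) (c₀ : ℝ) (hc₀ : 0 < c₀) :
    ∃ C : ℝ, 0 < C ∧ ∀ t s : ℝ, 0 < s → s ≤ t →
      (∫ r in ((c₀ / 4) * s ^ (1 / α))..(c₀ * t ^ (1 / α) - (c₀ / 4) * s ^ (1 / α)),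
        r ^ (-1 - α) * (c₀ * t ^ (1 / α) - r) ^ (-α)) ≤ C / (t * s) := by
  refine ⟨2 / α * ((c₀ / 2) ^ (-α) * (c₀ / 4) ^ (-α)), by positivity, fun t s hs hst => ?_⟩
  have ht : 0 < t := hs.trans_le hst
  have hle : s ^ (1 / α) ≤ t ^ (1 / α) := Real.rpow_le_rpow hs.le hst (by positivity)
  have hsp : 0 < s ^ (1 / α) := by positivity
  have scale {c x : ℝ} (hc : 0 < c) (hx : 0 < x) :
      (c * x ^ (1 / α)) ^ (-α) = c ^ (-α) * x⁻¹ := by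
    rw [Real.mul_rpow hc.le (by positivity), ← Real.rpow_mul hx.le,
      show 1 / α * -α = -1 by field_simp, Real.rpow_neg_one]
  refine (intervalIntegral_rpow_mul_sub_rpow_le hα1 (by positivity) (by nlinarith)).trans_eq ?_
  rw [mul_div_right_comm, scale (by positivity) ht, scale (by positivity) hs]
  field_simp
end

section
/- Let α>0 and let g:[0,∞)→[1,∞) be non-decreasing with g(2r) ≤ C₁·g(r) for all r≥0 for some constant C₁>0. For all K₁,K₂>0 there exists a constant C≥1 such that whenever s₁,s₂≥0 and t>0 satisfy t ≤ K₁·t₀(s₁) and s₂ ≤ s₁ + K₂·t^{1/α}, then g(s₂) ≤ C·g(s₁). -/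
/-- Iterating the doubling condition. -/
theorem doubling_pow {g : ℝ → ℝ} {C : ℝ} (hC : 0 ≤ C)
    (hdbl : ∀ r : ℝ, 0 ≤ r → g (2 * r) ≤ C * g r) (n : ℕ) {r : ℝ} (hr : 0 ≤ r) :
    g (2 ^ n * r) ≤ C ^ n * g r := by
  induction n with
  | zero => simp
  | succ k ih =>
    calc g (2 ^ (k + 1) * r) = g (2 * (2 ^ k * r)) := by ring_nf
      _ ≤ C * g (2 ^ k * r) := hdbl _ (by positivity)
      _ ≤ C * (C ^ k * g r) := by gcongr
      _ = C ^ (k + 1) * g r := by ring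

/-- A positive solution of `exp (-(t * a)) = t / b ^ α` with `a ≥ 0` satisfies `t ≤ b ^ α`. -/
theorem le_rpow_of_exp_neg_eq {t a b α : ℝ} (ht : 0 < t) (ha : 0 ≤ a) (hb : 0 < b)
    (h : Real.exp (-(t * a)) = t / b ^ α) : t ≤ b ^ α := by
  have hexp : Real.exp (-(t * a)) ≤ 1 := Real.exp_le_one_iff.2 (by nlinarith)
  rwa [h, div_le_one (Real.rpow_pos_of_pos hb α)] at hexp


/-- For `α > 0`, `g : [0,∞) → [1,∞)` non-decreasing and doubling, and `t₀ s` the unique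
positive solution of `exp (-(t * g s)) = t / (1+s)^α`: for all `K₁, K₂ > 0` there is
`C ≥ 1` such that whenever `s₁, s₂ ≥ 0` and `t > 0` satisfy `t ≤ K₁ t₀(s₁)` and
`s₂ ≤ s₁ + K₂ t^{1/α}`, then `g s₂ ≤ C g s₁`. -/
theorem stmt_18 (α : ℝ) (hα : 0 < α) (g : ℝ → ℝ)
    (hg1 : ∀ r : ℝ, 0 ≤ r → 1 ≤ g r)
    (hmono : ∀ r s : ℝ, 0 ≤ r → r ≤ s → g r ≤ g s)
    (C₁ : ℝ) (hC₁ : 0 < C₁) (hdbl : ∀ r : ℝ, 0 ≤ r → g (2 * r) ≤ C₁ * g r)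
    (t₀ : ℝ → ℝ)
    (ht₀ : ∀ s : ℝ, 0 ≤ s →
      0 < t₀ s ∧ Real.exp (-(t₀ s * g s)) = t₀ s / (1 + s) ^ α) :
    ∀ K₁ K₂ : ℝ, 0 < K₁ → 0 < K₂ → ∃ C : ℝ, 1 ≤ C ∧
      ∀ s₁ s₂ t : ℝ, 0 ≤ s₁ → 0 ≤ s₂ → 0 < t → t ≤ K₁ * t₀ s₁ →
        s₂ ≤ s₁ + K₂ * t ^ (1 / α) → g s₂ ≤ C * g s₁ := by
  intro K₁ K₂ hK₁ hK₂
  have hC₁' : 1 ≤ C₁ := by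
    have h0 := hdbl 0 le_rfl
    have h1 := hg1 0 le_rfl
    rw [mul_zero] at h0
    nlinarith
  set K : ℝ := K₂ * K₁ ^ (1 / α) with hK
  have hK0 : 0 < K := by positivity
  obtain ⟨n, hn⟩ := pow_unbounded_of_one_lt (2 * (K + 1)) (one_lt_two (α := ℝ))
  have hpow : 1 ≤ C₁ ^ n := one_le_pow₀ hC₁'
  have hg := hg1 1 zero_le_one
  refine ⟨C₁ ^ n * g 1, one_le_mul_of_one_le_of_one_le hpow hg, ?_⟩
  intro s₁ s₂ t hs₁ hs₂ ht htK hs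
  have hgs := hg1 s₁ hs₁
  have hroot : t ^ (1 / α) ≤ K₁ ^ (1 / α) * (1 + s₁) := by
    have hle : t ≤ K₁ * (1 + s₁) ^ α := htK.trans <| by
      gcongr
      exact le_rpow_of_exp_neg_eq (ht₀ s₁ hs₁).1 (by linarith) (by linarith) (ht₀ s₁ hs₁).2
    calc t ^ (1 / α) ≤ (K₁ * (1 + s₁) ^ α) ^ (1 / α) := by gcongr
      _ = K₁ ^ (1 / α) * (1 + s₁) := by
        rw [Real.mul_rpow hK₁.le (by positivity), one_div,
          Real.rpow_rpow_inv (by positivity) hα.ne']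
  have hs' : s₂ ≤ s₁ + K * (1 + s₁) := by
    rw [hK, mul_assoc]
    exact hs.trans (by gcongr)
  have hmax : s₂ ≤ 2 ^ n * max 1 s₁ := by
    have h1 := le_max_left 1 s₁
    have h2 := le_max_right 1 s₁
    nlinarith
  have hgmax : g (max 1 s₁) ≤ g 1 * g s₁ := by
    rcases max_choice 1 s₁ with h | h <;> rw [h] <;> nlinarith
  calc g s₂ ≤ g (2 ^ n * max 1 s₁) := hmono _ _ hs₂ hmax
    _ ≤ C₁ ^ n * g (max 1 s₁) := doubling_pow hC₁.le hdbl n (by positivity)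
    _ ≤ C₁ ^ n * (g 1 * g s₁) := by gcongr
    _ = C₁ ^ n * g 1 * g s₁ := by ring
end

section
/- Let d∈ℕ, α>0, let g:[0,∞)→[1,∞), and let C₃,C₄>0. Suppose F:(0,∞)×ℝ^d→[0,∞) satisfies: (i) for each x∈ℝ^d the map t ↦ F(t,x) is non-increasing; (ii) F(t,x) ≤ C₃·(exp(−C₄·t·g(|x|)) + t·(1+|x|)^{−α}) for all t>0 and x∈ℝ^d. Then there exist constants C₅,C₆>0 such that F(t,x) ≤ C₆·log(2+|x|)·(1+|x|)^{−α} for all x∈ℝ^d and all t ≥ C₅·t₀(|x|). -/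
/-- A positive solution of `exp (-(t * c)) = t / (1 + s) ^ α` with `c ≥ 1` grows at most
logarithmically in `s`. -/
theorem le_mul_log_of_exp_neg_eq {α s c t : ℝ} (hα : 0 < α) (hs : 0 ≤ s) (hc : 1 ≤ c)
    (ht : 0 < t) (h : Real.exp (-(t * c)) = t / (1 + s) ^ α) :
    t ≤ (2 + α) * Real.log (2 + s) := by
  have hlog2 : 1 / 2 ≤ Real.log (2 + s) := by
    have := Real.log_le_log (by norm_num : (0 : ℝ) < 2) (by linarith : 2 ≤ 2 + s)
    linarith [Real.log_two_gt_d9]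
  rcases le_total t 1 with h1 | h1
  · nlinarith
  · have hp : 0 < (1 + s) ^ α := by positivity
    have hlog := congrArg Real.log h
    rw [Real.log_exp, Real.log_div ht.ne' hp.ne', Real.log_rpow (by linarith)] at hlog
    have hmono := Real.log_le_log (by linarith : 0 < 1 + s) (by linarith : 1 + s ≤ 2 + s)
    nlinarith [Real.log_nonneg h1, mul_le_mul_of_nonneg_left hmono hα.le]

/-- For `d ∈ ℕ`, `α > 0`, `g : [0,∞) → [1,∞)`, `t₀ s` the unique positive solution of
`exp (-(t * g s)) = t / (1+s)^α`, and `C₃, C₄ > 0`: if `F : (0,∞) × ℝ^d → [0,∞)` is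
non-increasing in time and satisfies `F t x ≤ C₃ (e^{-C₄ t g(|x|)} + t (1+|x|)^{-α})`,
then there are `C₅, C₆ > 0` such that `F t x ≤ C₆ log (2+|x|) (1+|x|)^{-α}` for all `x`
and `t ≥ C₅ t₀(|x|)`. -/
theorem stmt_19 (d : ℕ) (hd : 0 < d) (α : ℝ) (hα : 0 < α) (g : ℝ → ℝ)
    (hg1 : ∀ r : ℝ, 0 ≤ r → 1 ≤ g r)
    (t₀ : ℝ → ℝ)
    (ht₀ : ∀ s : ℝ, 0 ≤ s →
      0 < t₀ s ∧ Real.exp (-(t₀ s * g s)) = t₀ s / (1 + s) ^ α)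
    (C₃ C₄ : ℝ) (hC₃ : 0 < C₃) (hC₄ : 0 < C₄)
    (F : ℝ → EuclideanSpace ℝ (Fin d) → ℝ)
    (hFnonneg : ∀ t : ℝ, 0 < t → ∀ x, 0 ≤ F t x)
    (hFmono : ∀ x, ∀ t₁ t₂ : ℝ, 0 < t₁ → t₁ ≤ t₂ → F t₂ x ≤ F t₁ x)
    (hFbd : ∀ t : ℝ, 0 < t → ∀ x,
      F t x ≤ C₃ * (Real.exp (-(C₄ * t * g ‖x‖)) + t * (1 + ‖x‖) ^ (-α))) :
    ∃ C₅ C₆ : ℝ, 0 < C₅ ∧ 0 < C₆ ∧ ∀ x, ∀ t : ℝ, C₅ * t₀ ‖x‖ ≤ t →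
      F t x ≤ C₆ * Real.log (2 + ‖x‖) * (1 + ‖x‖) ^ (-α) := by
  refine ⟨1 / C₄, C₃ * (1 + 1 / C₄) * (2 + α), by positivity, by positivity, fun x t ht => ?_⟩
  obtain ⟨hpos, heq⟩ := ht₀ ‖x‖ (norm_nonneg x)
  have hlog := le_mul_log_of_exp_neg_eq hα (norm_nonneg x) (hg1 _ (norm_nonneg x)) hpos heq
  have hpos' : 0 < 1 / C₄ * t₀ ‖x‖ := by positivity
  have hexp : Real.exp (-(C₄ * (1 / C₄ * t₀ ‖x‖) * g ‖x‖)) = t₀ ‖x‖ * (1 + ‖x‖) ^ (-α) := by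
    rw [← mul_assoc C₄, mul_one_div_cancel hC₄.ne', one_mul, heq,
      Real.rpow_neg (by positivity), div_eq_mul_inv]
  calc F t x ≤ F (1 / C₄ * t₀ ‖x‖) x := hFmono x _ _ hpos' ht
    _ ≤ C₃ * (Real.exp (-(C₄ * (1 / C₄ * t₀ ‖x‖) * g ‖x‖))
          + 1 / C₄ * t₀ ‖x‖ * (1 + ‖x‖) ^ (-α)) := hFbd _ hpos' x
    _ = C₃ * (1 + 1 / C₄) * t₀ ‖x‖ * (1 + ‖x‖) ^ (-α) := by rw [hexp]; ring
    _ ≤ C₃ * (1 + 1 / C₄) * ((2 + α) * Real.log (2 + ‖x‖)) * (1 + ‖x‖) ^ (-α) := by gcongr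
    _ = C₃ * (1 + 1 / C₄) * (2 + α) * Real.log (2 + ‖x‖) * (1 + ‖x‖) ^ (-α) := by ring
end
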